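/- Suppose both agents' feedback KKT systems hold (so in particular ψ^i_s = 0 for all s), and for agent i the feedback second-order sufficiency condition holds: Q^{i,FB}(d) > 0 for every nonzero feedback critical direction d. Then the open-loop second-order sufficiency condition holds for agent i: Q^{i,OL}(d) > 0 for every nonzero open-loop critical direction d. -/

import Mathlib

open Matrix

noncomputable def grad {p : ℕ} (G : (Fin p → ℝ) → ℝ) (a : Fin p → ℝ) : Fin p → ℝ :=
  fun j => fderiv ℝ G a (Pi.single j 1)

noncomputable def jacT {p q : ℕ} (F : (Fin p → ℝ) → Fin q → ℝ) (a : Fin p → ℝ)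
    (lam : Fin q → ℝ) : Fin p → ℝ :=
  fun j => lam ⬝ᵥ fderiv ℝ F a (Pi.single j 1)

noncomputable def hess2 {E : Type*} [NormedAddCommGroup E] [NormedSpace ℝ E]
    (G : E → ℝ) (a d : E) : ℝ :=
  iteratedFDeriv ℝ 2 G a ![d, d]

/-- Open-loop quadratic form for agent 1. -/
noncomputable def QOL1 {n m1 m2 : ℕ} (K : ℕ)
    (f : ℕ → (Fin n → ℝ) → (Fin m1 → ℝ) → (Fin m2 → ℝ) → Fin n → ℝ)
    (l : ℕ → (Fin n → ℝ) → (Fin m1 → ℝ) → (Fin m2 → ℝ) → ℝ)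
    (lf : (Fin n → ℝ) → ℝ)
    (x : ℕ → Fin n → ℝ) (u1 : ℕ → Fin m1 → ℝ) (u2 : ℕ → Fin m2 → ℝ)
    (lam1 : ℕ → Fin n → ℝ)
    (du1 : ℕ → Fin m1 → ℝ) (dx : ℕ → Fin n → ℝ) : ℝ :=
  hess2 (fun w => l 1 (x 1) w (u2 1)) (u1 1) (du1 1)
    + ∑ s ∈ Finset.Icc 2 K, hess2
        (fun p : (Fin n → ℝ) × (Fin m1 → ℝ) =>
          l s p.1 p.2 (u2 s) + lam1 s ⬝ᵥ f s p.1 p.2 (u2 s))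
        (x s, u1 s) (dx s, du1 s)
    + hess2 lf (x (K+1)) (dx (K+1))

/-- Open-loop quadratic form for agent 2 (cost `-l`). -/
noncomputable def QOL2 {n m1 m2 : ℕ} (K : ℕ)
    (f : ℕ → (Fin n → ℝ) → (Fin m1 → ℝ) → (Fin m2 → ℝ) → Fin n → ℝ)
    (l : ℕ → (Fin n → ℝ) → (Fin m1 → ℝ) → (Fin m2 → ℝ) → ℝ)
    (lf : (Fin n → ℝ) → ℝ)
    (x : ℕ → Fin n → ℝ) (u1 : ℕ → Fin m1 → ℝ) (u2 : ℕ → Fin m2 → ℝ)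
    (lam2 : ℕ → Fin n → ℝ)
    (du2 : ℕ → Fin m2 → ℝ) (dx : ℕ → Fin n → ℝ) : ℝ :=
  hess2 (fun w => -(l 1 (x 1) (u1 1) w)) (u2 1) (du2 1)
    + ∑ s ∈ Finset.Icc 2 K, hess2
        (fun p : (Fin n → ℝ) × (Fin m2 → ℝ) =>
          -(l s p.1 (u1 s) p.2) + lam2 s ⬝ᵥ f s p.1 (u1 s) p.2)
        (x s, u2 s) (dx s, du2 s)
    + hess2 (fun y => -(lf y)) (x (K+1)) (dx (K+1))

/-- Feedback quadratic form for agent 1. -/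
noncomputable def QFB1 {n m1 m2 : ℕ} (K : ℕ)
    (f : ℕ → (Fin n → ℝ) → (Fin m1 → ℝ) → (Fin m2 → ℝ) → Fin n → ℝ)
    (l : ℕ → (Fin n → ℝ) → (Fin m1 → ℝ) → (Fin m2 → ℝ) → ℝ)
    (lf : (Fin n → ℝ) → ℝ)
    (x : ℕ → Fin n → ℝ) (u1 : ℕ → Fin m1 → ℝ) (u2 : ℕ → Fin m2 → ℝ)
    (pi2 : ℕ → (Fin n → ℝ) → Fin m2 → ℝ)
    (lam1 : ℕ → Fin n → ℝ) (psi1 : ℕ → Fin m2 → ℝ)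
    (du1 : ℕ → Fin m1 → ℝ) (du2 : ℕ → Fin m2 → ℝ) (dx : ℕ → Fin n → ℝ) : ℝ :=
  hess2 (fun w => l 1 (x 1) w (u2 1)) (u1 1) (du1 1)
    + ∑ s ∈ Finset.Icc 2 K, hess2
        (fun p : (Fin n → ℝ) × (Fin m1 → ℝ) × (Fin m2 → ℝ) =>
          l s p.1 p.2.1 p.2.2 + lam1 s ⬝ᵥ f s p.1 p.2.1 p.2.2 + psi1 s ⬝ᵥ pi2 s p.1)
        (x s, u1 s, u2 s) (dx s, du1 s, du2 s)
    + hess2 lf (x (K+1)) (dx (K+1))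

/-- Feedback quadratic form for agent 2 (cost `-l`). -/
noncomputable def QFB2 {n m1 m2 : ℕ} (K : ℕ)
    (f : ℕ → (Fin n → ℝ) → (Fin m1 → ℝ) → (Fin m2 → ℝ) → Fin n → ℝ)
    (l : ℕ → (Fin n → ℝ) → (Fin m1 → ℝ) → (Fin m2 → ℝ) → ℝ)
    (lf : (Fin n → ℝ) → ℝ)
    (x : ℕ → Fin n → ℝ) (u1 : ℕ → Fin m1 → ℝ) (u2 : ℕ → Fin m2 → ℝ)
    (pi1 : ℕ → (Fin n → ℝ) → Fin m1 → ℝ)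
    (lam2 : ℕ → Fin n → ℝ) (psi2 : ℕ → Fin m1 → ℝ)
    (du1 : ℕ → Fin m1 → ℝ) (du2 : ℕ → Fin m2 → ℝ) (dx : ℕ → Fin n → ℝ) : ℝ :=
  hess2 (fun w => -(l 1 (x 1) (u1 1) w)) (u2 1) (du2 1)
    + ∑ s ∈ Finset.Icc 2 K, hess2
        (fun p : (Fin n → ℝ) × (Fin m1 → ℝ) × (Fin m2 → ℝ) =>
          -(l s p.1 p.2.1 p.2.2) + lam2 s ⬝ᵥ f s p.1 p.2.1 p.2.2 + psi2 s ⬝ᵥ pi1 s p.1)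
        (x s, u1 s, u2 s) (dx s, du1 s, du2 s)
    + hess2 (fun y => -(lf y)) (x (K+1)) (dx (K+1))

/-- Open-loop critical direction for agent 1. -/
def OLdir1 {n m1 m2 : ℕ} (K : ℕ)
    (f : ℕ → (Fin n → ℝ) → (Fin m1 → ℝ) → (Fin m2 → ℝ) → Fin n → ℝ)
    (x : ℕ → Fin n → ℝ) (u1 : ℕ → Fin m1 → ℝ) (u2 : ℕ → Fin m2 → ℝ)
    (du1 : ℕ → Fin m1 → ℝ) (dx : ℕ → Fin n → ℝ) : Prop :=
  dx 2 = fderiv ℝ (fun w => f 1 (x 1) w (u2 1)) (u1 1) (du1 1) ∧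
  ∀ s, 2 ≤ s → s ≤ K → dx (s+1) =
    fderiv ℝ (fun y => f s y (u1 s) (u2 s)) (x s) (dx s)
      + fderiv ℝ (fun w => f s (x s) w (u2 s)) (u1 s) (du1 s)

/-- Open-loop critical direction for agent 2. -/
def OLdir2 {n m1 m2 : ℕ} (K : ℕ)
    (f : ℕ → (Fin n → ℝ) → (Fin m1 → ℝ) → (Fin m2 → ℝ) → Fin n → ℝ)
    (x : ℕ → Fin n → ℝ) (u1 : ℕ → Fin m1 → ℝ) (u2 : ℕ → Fin m2 → ℝ)
    (du2 : ℕ → Fin m2 → ℝ) (dx : ℕ → Fin n → ℝ) : Prop :=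
  dx 2 = fderiv ℝ (fun w => f 1 (x 1) (u1 1) w) (u2 1) (du2 1) ∧
  ∀ s, 2 ≤ s → s ≤ K → dx (s+1) =
    fderiv ℝ (fun y => f s y (u1 s) (u2 s)) (x s) (dx s)
      + fderiv ℝ (fun w => f s (x s) (u1 s) w) (u2 s) (du2 s)

/-- Feedback critical direction for agent 1. -/
def FBdir1 {n m1 m2 : ℕ} (K : ℕ)
    (f : ℕ → (Fin n → ℝ) → (Fin m1 → ℝ) → (Fin m2 → ℝ) → Fin n → ℝ)
    (x : ℕ → Fin n → ℝ) (u1 : ℕ → Fin m1 → ℝ) (u2 : ℕ → Fin m2 → ℝ)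
    (du1 : ℕ → Fin m1 → ℝ) (du2 : ℕ → Fin m2 → ℝ) (dx : ℕ → Fin n → ℝ) : Prop :=
  dx 2 = fderiv ℝ (fun w => f 1 (x 1) w (u2 1)) (u1 1) (du1 1) ∧
  ∀ s, 2 ≤ s → s ≤ K → dx (s+1) =
    fderiv ℝ (fun y => f s y (u1 s) (u2 s)) (x s) (dx s)
      + fderiv ℝ (fun w => f s (x s) w (u2 s)) (u1 s) (du1 s)
      + fderiv ℝ (fun w => f s (x s) (u1 s) w) (u2 s) (du2 s)

/-- Feedback critical direction for agent 2. -/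
def FBdir2 {n m1 m2 : ℕ} (K : ℕ)
    (f : ℕ → (Fin n → ℝ) → (Fin m1 → ℝ) → (Fin m2 → ℝ) → Fin n → ℝ)
    (x : ℕ → Fin n → ℝ) (u1 : ℕ → Fin m1 → ℝ) (u2 : ℕ → Fin m2 → ℝ)
    (du1 : ℕ → Fin m1 → ℝ) (du2 : ℕ → Fin m2 → ℝ) (dx : ℕ → Fin n → ℝ) : Prop :=
  dx 2 = fderiv ℝ (fun w => f 1 (x 1) (u1 1) w) (u2 1) (du2 1) ∧
  ∀ s, 2 ≤ s → s ≤ K → dx (s+1) =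
    fderiv ℝ (fun y => f s y (u1 s) (u2 s)) (x s) (dx s)
      + fderiv ℝ (fun w => f s (x s) w (u2 s)) (u1 s) (du1 s)
      + fderiv ℝ (fun w => f s (x s) (u1 s) w) (u2 s) (du2 s)

theorem grad_neg {p : ℕ} (G : (Fin p → ℝ) → ℝ) (a : Fin p → ℝ) :
    grad (fun y => -(G y)) a = -grad G a := by
  funext j
  simp [grad, fderiv_fun_neg]

theorem jacT_neg {p q : ℕ} (F : (Fin p → ℝ) → Fin q → ℝ) (a : Fin p → ℝ)
    (lam : Fin q → ℝ) : jacT F a (-lam) = -jacT F a lam := by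
  funext j
  simp [jacT]

theorem jacT_zero {p q : ℕ} (F : (Fin p → ℝ) → Fin q → ℝ) (a : Fin p → ℝ) :
    jacT F a 0 = 0 := by
  funext j
  simp [jacT]

theorem hess2_comp_affine {E F : Type*} [NormedAddCommGroup E] [NormedSpace ℝ E]
    [NormedAddCommGroup F] [NormedSpace ℝ F] {G : F → ℝ} (hG : ContDiff ℝ 2 G)
    (c : F) (L : E →L[ℝ] F) (a d : E) :
    hess2 (fun p => G (c + L p)) a d = hess2 G (c + L a) (L d) := by
  have hT : ContDiff ℝ 2 (fun y => G (c + y)) := by fun_prop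
  unfold hess2
  have h := L.iteratedFDeriv_comp_right hT a (i := 2) le_rfl
  have h' := congrArg (fun M => M ![d, d]) h
  simp only [Function.comp_def, ContinuousMultilinearMap.compContinuousLinearMap_apply,
    iteratedFDeriv_comp_add_left] at h'
  rw [h']
  congr 1
  funext i
  fin_cases i <;> rfl

theorem ContDiff.const_dotProduct {E : Type*} [NormedAddCommGroup E] [NormedSpace ℝ E]
    {q : ℕ} {k : WithTop ℕ∞} {F : E → Fin q → ℝ} (hF : ContDiff ℝ k F) (lam : Fin q → ℝ) :
    ContDiff ℝ k (fun p => lam ⬝ᵥ F p) := by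
  simp only [dotProduct]
  fun_prop

theorem hess2_fix_snd_snd {E F H : Type*} [NormedAddCommGroup E] [NormedSpace ℝ E]
    [NormedAddCommGroup F] [NormedSpace ℝ F] [NormedAddCommGroup H] [NormedSpace ℝ H]
    {G : E × F × H → ℝ} (hG : ContDiff ℝ 2 G) (x dx : E) (u du : F) (v : H) :
    hess2 (fun p : E × F => G (p.1, p.2, v)) (x, u) (dx, du)
      = hess2 G (x, u, v) (dx, du, 0) := by
  simpa using hess2_comp_affine hG (0, 0, v)
    ((ContinuousLinearMap.fst ℝ E F).prod ((ContinuousLinearMap.snd ℝ E F).prod 0))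
    (x, u) (dx, du)

theorem hess2_fix_snd_fst {E F H : Type*} [NormedAddCommGroup E] [NormedSpace ℝ E]
    [NormedAddCommGroup F] [NormedSpace ℝ F] [NormedAddCommGroup H] [NormedSpace ℝ H]
    {G : E × F × H → ℝ} (hG : ContDiff ℝ 2 G) (x dx : E) (u : F) (v dv : H) :
    hess2 (fun p : E × H => G (p.1, u, p.2)) (x, v) (dx, dv)
      = hess2 G (x, u, v) (dx, 0, dv) := by
  simpa using hess2_comp_affine hG (0, u, 0)
    ((ContinuousLinearMap.fst ℝ E H).prod
      ((0 : E × H →L[ℝ] F).prod (ContinuousLinearMap.snd ℝ E H)))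
    (x, v) (dx, dv)

/-- Under both agents' feedback KKT systems, the feedback second-order
sufficiency condition for agent `i` implies the open-loop second-order sufficiency
condition for agent `i`. -/
theorem fb_second_order_sufficiency_implies_ol
    {n m1 m2 K : ℕ} (hK : 1 ≤ K)
    (f : ℕ → (Fin n → ℝ) → (Fin m1 → ℝ) → (Fin m2 → ℝ) → Fin n → ℝ)
    (l : ℕ → (Fin n → ℝ) → (Fin m1 → ℝ) → (Fin m2 → ℝ) → ℝ)
    (lf : (Fin n → ℝ) → ℝ)
    (x : ℕ → Fin n → ℝ) (u1 : ℕ → Fin m1 → ℝ) (u2 : ℕ → Fin m2 → ℝ)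
    (pi1 : ℕ → (Fin n → ℝ) → Fin m1 → ℝ) (pi2 : ℕ → (Fin n → ℝ) → Fin m2 → ℝ)
    (lam1 lam2 : ℕ → Fin n → ℝ)
    (psi1 : ℕ → Fin m2 → ℝ) (psi2 : ℕ → Fin m1 → ℝ)
    (hf2 : ∀ t, 1 ≤ t → t ≤ K → ContDiff ℝ 2
      (fun p : (Fin n → ℝ) × (Fin m1 → ℝ) × (Fin m2 → ℝ) => f t p.1 p.2.1 p.2.2))
    (hl2 : ∀ t, 1 ≤ t → t ≤ K → ContDiff ℝ 2
      (fun p : (Fin n → ℝ) × (Fin m1 → ℝ) × (Fin m2 → ℝ) => l t p.1 p.2.1 p.2.2))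
    (hlf2 : ContDiff ℝ 2 lf)
    (hpi1d : ∀ s, 2 ≤ s → s ≤ K → ContDiff ℝ 2 (pi1 s))
    (hpi2d : ∀ s, 2 ≤ s → s ≤ K → ContDiff ℝ 2 (pi2 s))
    (hdyn : ∀ t, 1 ≤ t → t ≤ K → x (t+1) = f t (x t) (u1 t) (u2 t))
    (hpc1 : ∀ s, 2 ≤ s → s ≤ K → pi1 s (x s) = u1 s)
    (hpc2 : ∀ s, 2 ≤ s → s ≤ K → pi2 s (x s) = u2 s)
    (hFB1a : ∀ s, 2 ≤ s → s ≤ K → grad (fun w => l s (x s) (u1 s) w) (u2 s)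
      + jacT (fun w => f s (x s) (u1 s) w) (u2 s) (lam1 s) - psi1 s = 0)
    (hFB1b : ∀ s, 2 ≤ s → s ≤ K → grad (fun w => -(l s (x s) w (u2 s))) (u1 s)
      + jacT (fun w => f s (x s) w (u2 s)) (u1 s) (lam2 s) - psi2 s = 0)
    (hFB2a : ∀ t, 1 ≤ t → t ≤ K → grad (fun w => l t (x t) w (u2 t)) (u1 t)
      + jacT (fun w => f t (x t) w (u2 t)) (u1 t) (lam1 t) = 0)
    (hFB2b : ∀ t, 1 ≤ t → t ≤ K → grad (fun w => -(l t (x t) (u1 t) w)) (u2 t)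
      + jacT (fun w => f t (x t) (u1 t) w) (u2 t) (lam2 t) = 0)
    (hFB3a : grad lf (x (K+1)) - lam1 K = 0)
    (hFB3b : grad (fun y => -(lf y)) (x (K+1)) - lam2 K = 0)
    (hFB4a : ∀ s, 2 ≤ s → s ≤ K → grad (fun y => l s y (u1 s) (u2 s)) (x s) - lam1 (s-1)
      + jacT (fun y => f s y (u1 s) (u2 s)) (x s) (lam1 s) + jacT (pi2 s) (x s) (psi1 s) = 0)
    (hFB4b : ∀ s, 2 ≤ s → s ≤ K → grad (fun y => -(l s y (u1 s) (u2 s))) (x s) - lam2 (s-1)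
      + jacT (fun y => f s y (u1 s) (u2 s)) (x s) (lam2 s) + jacT (pi1 s) (x s) (psi2 s) = 0)
 :
    ((∀ (du1 : ℕ → Fin m1 → ℝ) (du2 : ℕ → Fin m2 → ℝ) (dx : ℕ → Fin n → ℝ),
        FBdir1 K f x u1 u2 du1 du2 dx →
        ¬((∀ t, 1 ≤ t → t ≤ K → du1 t = 0) ∧ (∀ s, 2 ≤ s → s ≤ K → du2 s = 0) ∧
            (∀ s, 2 ≤ s → s ≤ K+1 → dx s = 0)) →
        0 < QFB1 K f l lf x u1 u2 pi2 lam1 psi1 du1 du2 dx) →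
      ∀ (du1 : ℕ → Fin m1 → ℝ) (dx : ℕ → Fin n → ℝ),
        OLdir1 K f x u1 u2 du1 dx →
        ¬((∀ t, 1 ≤ t → t ≤ K → du1 t = 0) ∧ (∀ s, 2 ≤ s → s ≤ K+1 → dx s = 0)) →
        0 < QOL1 K f l lf x u1 u2 lam1 du1 dx) ∧
    ((∀ (du1 : ℕ → Fin m1 → ℝ) (du2 : ℕ → Fin m2 → ℝ) (dx : ℕ → Fin n → ℝ),
        FBdir2 K f x u1 u2 du1 du2 dx →
        ¬((∀ t, 1 ≤ t → t ≤ K → du2 t = 0) ∧ (∀ s, 2 ≤ s → s ≤ K → du1 s = 0) ∧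
            (∀ s, 2 ≤ s → s ≤ K+1 → dx s = 0)) →
        0 < QFB2 K f l lf x u1 u2 pi1 lam2 psi2 du1 du2 dx) →
      ∀ (du2 : ℕ → Fin m2 → ℝ) (dx : ℕ → Fin n → ℝ),
        OLdir2 K f x u1 u2 du2 dx →
        ¬((∀ t, 1 ≤ t → t ≤ K → du2 t = 0) ∧ (∀ s, 2 ≤ s → s ≤ K+1 → dx s = 0)) →
        0 < QOL2 K f l lf x u1 u2 lam2 du2 dx) := by
  simp only [grad_neg] at hFB1b hFB2b hFB3b hFB4b
  have psi1_eq_zero : ∀ s, 2 ≤ s → s ≤ K → lam2 s = -lam1 s → psi1 s = 0 := by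
    intro s hs hsK h
    have h1 := hFB1a s hs hsK
    have h2 := hFB2b s (by omega) hsK
    rw [h, jacT_neg] at h2
    linear_combination -h1 - h2
  have psi2_eq_zero : ∀ s, 2 ≤ s → s ≤ K → lam2 s = -lam1 s → psi2 s = 0 := by
    intro s hs hsK h
    have h1 := hFB1b s hs hsK
    have h2 := hFB2a s (by omega) hsK
    rw [h, jacT_neg] at h1
    linear_combination -h1 - h2
  have lam2_eq_neg : ∀ s, 1 ≤ s → s ≤ K → lam2 s = -lam1 s := by
    intro s hs hsK
    induction hsK using Nat.decreasingInduction with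
    | self => linear_combination -hFB3a - hFB3b
    | of_succ k hk ih =>
      have h := ih (by omega)
      have h1 := hFB4a (k + 1) (by omega) hk
      have h2 := hFB4b (k + 1) (by omega) hk
      rw [psi1_eq_zero (k + 1) (by omega) hk h, jacT_zero, Nat.add_sub_cancel] at h1
      rw [psi2_eq_zero (k + 1) (by omega) hk h, jacT_zero, h, jacT_neg,
        Nat.add_sub_cancel] at h2
      linear_combination -h1 - h2
  constructor
  · intro hsuff du1 dx hdir hne
    have hpos := hsuff du1 0 dx ⟨hdir.1, fun s hs hsK => by simpa using hdir.2 s hs hsK⟩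
      fun h => hne ⟨h.1, h.2.2⟩
    convert hpos using 1
    unfold QOL1 QFB1
    congr 2
    refine Finset.sum_congr rfl fun s hs => ?_
    obtain ⟨hs, hsK⟩ := Finset.mem_Icc.mp hs
    simp only [psi1_eq_zero s hs hsK (lam2_eq_neg s (by omega) hsK), zero_dotProduct, add_zero]
    exact hess2_fix_snd_snd ((hl2 s (by omega) hsK).add
      ((hf2 s (by omega) hsK).const_dotProduct (lam1 s))) (x s) (dx s) (u1 s) (du1 s) (u2 s)
  · intro hsuff du2 dx hdir hne
    have hpos := hsuff 0 du2 dx ⟨hdir.1, fun s hs hsK => by simpa using hdir.2 s hs hsK⟩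
      fun h => hne ⟨h.1, h.2.2⟩
    convert hpos using 1
    unfold QOL2 QFB2
    congr 2
    refine Finset.sum_congr rfl fun s hs => ?_
    obtain ⟨hs, hsK⟩ := Finset.mem_Icc.mp hs
    simp only [psi2_eq_zero s hs hsK (lam2_eq_neg s (by omega) hsK), zero_dotProduct, add_zero]
    exact hess2_fix_snd_fst ((hl2 s (by omega) hsK).neg.add
      ((hf2 s (by omega) hsK).const_dotProduct (lam2 s))) (x s) (dx s) (u1 s) (u2 s) (du2 s)
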